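/- Let $q$ and $q+2$ both be odd prime powers. Let $D = \{(x,y) \in \mathbb{F}_q \times \mathbb{F}_{q+2} : (x \text{ and } y \text{ are both nonzero squares}) \text{ or } (x \text{ and } y \text{ are both nonsquares}) \text{ or } y = 0\}$. Then $D$ is a $\left(q(q+2), \frac{q^2+2q-1}{2}, \frac{q^2+2q-3}{4}\right)$ difference set in the additive group $\mathbb{F}_q \times \mathbb{F}_{q+2}$. -/

import Mathlib

open scoped Classical

section Aux
open Finset

variable {F : Type*} [Field F] [Fintype F]

/-- indicator of zero -/
noncomputable def zind (x : F) : ℤ := if x = 0 then 1 else 0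

lemma sum_zind : ∑ x : F, zind x = 1 := by simp [zind]

lemma sum_zind_shift (a : F) : ∑ x : F, zind (x + a) = 1 := by
  rw [← sum_zind (F := F)]
  exact Equiv.sum_comp (Equiv.addRight a) zind

lemma sum_zind_mul (h : F → ℤ) : ∑ x : F, zind x * h x = h 0 := by simp [zind]

lemma sum_mul_zind_shift (h : F → ℤ) (a : F) : ∑ x : F, h x * zind (x + a) = h (-a) := by
  simp [zind, add_eq_zero_iff_eq_neg]

lemma sum_quad_shift (hF : ringChar F ≠ 2) (a : F) :
    ∑ x : F, quadraticChar F (x + a) = 0 := by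
  rw [← quadraticChar_sum_zero hF]
  exact Equiv.sum_comp (Equiv.addRight a) (quadraticChar F)

lemma sum_quad_quad (hF : ringChar F ≠ 2) (a : F) :
    ∑ x : F, quadraticChar F x * quadraticChar F (x + a)
      = (Fintype.card F : ℤ) * zind a - 1 := by
  by_cases ha : a = 0
  · subst ha
    have : ∀ x : F, quadraticChar F x * quadraticChar F (x + 0) = 1 - zind x := by
      intro x
      by_cases hx : x = 0
      · simp [hx, zind]
      · rw [add_zero, ← sq, quadraticChar_sq_one hx]; simp [zind, hx]
    simp only [this, sum_sub_distrib, sum_zind]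
    simp [zind]
  · have hJ := jacobiSum_nontrivial_inv (quadraticChar_ne_one hF)
    rw [(quadraticChar_isQuadratic F).inv] at hJ
    rw [jacobiSum] at hJ
    have hna : -a ≠ 0 := neg_ne_zero.mpr ha
    rw [← Equiv.sum_comp (Equiv.mulLeft₀ (-a) hna)]
    have : ∀ t : F, quadraticChar F (Equiv.mulLeft₀ (-a) hna t) *
        quadraticChar F (Equiv.mulLeft₀ (-a) hna t + a)
        = quadraticChar F (-1) * (quadraticChar F t * quadraticChar F (1 - t)) := by
      intro t
      have e1 : Equiv.mulLeft₀ (-a) hna t = (-1) * a * t := by simp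
      have e2 : (-1) * a * t + a = a * (1 - t) := by ring
      rw [e1, e2]
      simp only [map_mul]
      linear_combination (quadraticChar F (-1) * (quadraticChar F t * quadraticChar F (1 - t))) *
        quadraticChar_sq_one ha
    simp only [this, ← mul_sum, hJ]
    have := quadraticChar_sq_one (neg_ne_zero.mpr (one_ne_zero' F))
    simp only [zind, ha, if_false]
    linear_combination -this

lemma expand_inner {G : Type*} [Fintype G] (s t e e' : G → ℤ) (P Q d d' : ℤ) :
    ∑ y, (P * s y + e y - d + d * e y) * (Q * t y + e' y - d' + d' * e' y)
      = P * Q * ∑ y, s y * t y + P * (1 + d') * ∑ y, s y * e' y - P * d' * ∑ y, s y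
        + (1 + d) * Q * ∑ y, e y * t y + (1 + d) * (1 + d') * ∑ y, e y * e' y
        - (1 + d) * d' * ∑ y, e y - d * Q * ∑ y, t y - d * (1 + d') * ∑ y, e' y
        + d * d' * ∑ _y : G, 1 := by
  simp only [mul_sum, ← sum_add_distrib, ← sum_sub_distrib]
  exact sum_congr rfl fun y _ => by ring

lemma expand_outer {G : Type*} [Fintype G] (P Q d d' : G → ℤ) (A B C D E : ℤ) :
    ∑ x, (P x * Q x * A + P x * (1 + d' x) * B + (1 + d x) * Q x * C
        + (1 + d x) * (1 + d' x) * D - (1 + d x) * d' x * 1 - d x * (1 + d' x) * 1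
        + d x * d' x * E)
      = A * ∑ x, P x * Q x + B * ∑ x, P x + B * ∑ x, P x * d' x + C * ∑ x, Q x
        + C * ∑ x, d x * Q x + D * ∑ _x : G, 1 + (D - 1) * ∑ x, d x + (D - 1) * ∑ x, d' x
        + (D - 2 + E) * ∑ x, d x * d' x := by
  simp only [mul_sum, ← sum_add_distrib]
  exact sum_congr rfl fun y _ => by ring

/-- signed indicator -/
noncomputable def sgnf {F1 F2 : Type*} [Field F1] [Field F2] [Fintype F1] [Fintype F2]
    (x : F1) (y : F2) : ℤ :=
  quadraticChar F1 x * quadraticChar F2 y + zind y - zind x + zind x * zind y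

lemma sgnf_corr {F1 F2 : Type*} [Field F1] [Field F2] [Fintype F1] [Fintype F2]
    (hF1 : ringChar F1 ≠ 2) (hF2 : ringChar F2 ≠ 2)
    (hc : Fintype.card F2 = Fintype.card F1 + 2)
    (hm : quadraticChar F1 (-1) * quadraticChar F2 (-1) = -1)
    (a : F1) (b : F2) (hab : a ≠ 0 ∨ b ≠ 0) :
    ∑ x : F1, ∑ y : F2, sgnf x y * sgnf (x + a) (y + b) = -1 := by
  simp only [sgnf]
  have := fun x : F1 => expand_inner (fun y : F2 => quadraticChar F2 y)
    (fun y => quadraticChar F2 (y + b)) (fun y => zind y) (fun y => zind (y + b))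
    (quadraticChar F1 x) (quadraticChar F1 (x + a)) (zind x) (zind (x + a))
  simp only [this, sum_quad_quad hF2, sum_mul_zind_shift, quadraticChar_sum_zero hF2,
    sum_quad_shift hF2, sum_zind_mul (fun y => quadraticChar F2 (y + b)), sum_zind,
    sum_zind_shift, mul_zero, sub_zero]
  have h2 := expand_outer (fun x : F1 => quadraticChar F1 x)
    (fun x => quadraticChar F1 (x + a)) (fun x => zind x) (fun x => zind (x + a))
    (Fintype.card F2 * zind b - 1) (quadraticChar F2 (-b)) (quadraticChar F2 (0 + b)) (zind (-b))
    (∑ _y : F2, 1)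
  rw [h2]
  simp only [sum_quad_quad hF1, sum_mul_zind_shift, quadraticChar_sum_zero hF1,
    sum_quad_shift hF1, sum_zind_mul (fun y => quadraticChar F1 (y + a)), sum_zind,
    sum_zind_shift, mul_zero, zero_add]
  have e1 : quadraticChar F1 (-a) = quadraticChar F1 (-1) * quadraticChar F1 a := by
    rw [← map_mul]; simp
  have e2 : quadraticChar F2 (-b) = quadraticChar F2 (-1) * quadraticChar F2 b := by
    rw [← map_mul]; simp
  rw [e1, e2]
  have z1 : zind (-a) = zind a := by simp [zind]
  have z2 : zind (-b) = zind b := by simp [zind]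
  have z3 : zind a * zind b = 0 := by rcases hab with h | h <;> simp [zind, h]
  simp only [z1, z2, sum_const, card_univ, hc, nsmul_eq_mul]
  push_cast
  set n : ℤ := (Fintype.card F1 : ℤ)
  linear_combination (quadraticChar F1 a * quadraticChar F2 b) * hm +
    ((n + 2) * n + 1) * z3

lemma sgnf_sum {F1 F2 : Type*} [Field F1] [Field F2] [Fintype F1] [Fintype F2]
    (hF2 : ringChar F2 ≠ 2)
    (hc : Fintype.card F2 = Fintype.card F1 + 2) :
    ∑ x : F1, ∑ y : F2, sgnf x y = -1 := by
  simp only [sgnf, sum_add_distrib, sum_sub_distrib, ← mul_sum, quadraticChar_sum_zero hF2,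
    sum_zind, sum_const, card_univ, hc, nsmul_eq_mul, mul_one, mul_zero]
  push_cast
  ring

lemma sgnf_mem {F1 F2 : Type*} [Field F1] [Field F2] [Fintype F1] [Fintype F2]
    (x : F1) (y : F2) :
    2 * (if ((x ≠ 0 ∧ IsSquare x ∧ y ≠ 0 ∧ IsSquare y) ∨
      (¬ IsSquare x ∧ ¬ IsSquare y) ∨ y = 0) then (1 : ℤ) else 0) = 1 + sgnf x y := by
  by_cases hx : x = 0 <;> by_cases hy : y = 0 <;> by_cases sx : IsSquare x <;>
    by_cases sy : IsSquare y <;>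
    simp_all [sgnf, zind, quadraticCharFun]

end Aux

theorem stmt_16 (q : ℕ) (hq : IsPrimePow q) (hq2 : IsPrimePow (q + 2))
    (hodd : Odd q)
    {F1 F2 : Type*} [Field F1] [Field F2] [Fintype F1] [Fintype F2]
    (h1 : Fintype.card F1 = q) (h2 : Fintype.card F2 = q + 2)
    (D : Finset (F1 × F2))
    (hD : D = Finset.univ.filter (fun p : F1 × F2 =>
      (p.1 ≠ 0 ∧ IsSquare p.1 ∧ p.2 ≠ 0 ∧ IsSquare p.2) ∨
      (¬ IsSquare p.1 ∧ ¬ IsSquare p.2) ∨ p.2 = 0)) :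
    2 * D.card = q ^ 2 + 2 * q - 1 ∧
    ∀ g : F1 × F2, g ≠ 0 →
      4 * ((D ×ˢ D).filter (fun p => p.1 ≠ p.2 ∧ p.1 - p.2 = g)).card
        = q ^ 2 + 2 * q - 3 := by
  have hqm : q % 2 = 1 := Nat.odd_iff.mp hodd
  have hF1 : ringChar F1 ≠ 2 := fun h => by
    have := FiniteField.even_card_of_char_two h
    omega
  have hF2 : ringChar F2 ≠ 2 := fun h => by
    have := FiniteField.even_card_of_char_two h
    omega
  have hc : Fintype.card F2 = Fintype.card F1 + 2 := by omega
  have hm : quadraticChar F1 (-1) * quadraticChar F2 (-1) = -1 := by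
    rw [quadraticChar_neg_one hF1, quadraticChar_neg_one hF2, ZMod.χ₄_nat_eq_if_mod_four,
      ZMod.χ₄_nat_eq_if_mod_four, h1, h2]
    have : q % 4 = 1 ∨ q % 4 = 3 := by omega
    rcases this with h | h
    · have h' : (q + 2) % 4 = 3 := by omega
      have h'' : (q + 2) % 2 = 1 := by omega
      simp [h, h', hqm]
    · have h' : (q + 2) % 4 = 1 := by omega
      have h'' : (q + 2) % 2 = 1 := by omega
      simp [h, h', hqm]
  have hq1 : 1 < q := hq.one_lt
  have hmem : ∀ p : F1 × F2, 2 * (if p ∈ D then (1 : ℤ) else 0) = 1 + sgnf p.1 p.2 := by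
    intro p
    rw [← sgnf_mem, hD]
    simp only [Finset.mem_filter, Finset.mem_univ, true_and]
  have hv : ∑ _p : F1 × F2, (1 : ℤ) = q * (q + 2) := by
    simp [h1, h2]
  have hs : ∑ p : F1 × F2, sgnf p.1 p.2 = -1 := by
    rw [Fintype.sum_prod_type]; exact sgnf_sum hF2 hc
  constructor
  · have : (2 * D.card : ℤ) = q * (q + 2) - 1 := by
      have : (D.card : ℤ) = ∑ p : F1 × F2, if p ∈ D then (1 : ℤ) else 0 := by simp
      rw [this, Finset.mul_sum]
      simp only [hmem, Finset.sum_add_distrib, hv, hs]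
      ring
    have h3 : 2 * D.card + 1 = q ^ 2 + 2 * q := by
      zify; linear_combination this
    omega
  · intro g hg
    have hcard : ((D ×ˢ D).filter (fun p => p.1 ≠ p.2 ∧ p.1 - p.2 = g)).card
        = (Finset.univ.filter (fun p : F1 × F2 => p ∈ D ∧ p + g ∈ D)).card := by
      symm
      apply Finset.card_bij (fun p _ => (p + g, p))
      · intro p hp
        simp only [Finset.mem_filter, Finset.mem_univ, true_and] at hp
        simp [hp.1, hp.2, hg]
      · intro p _ p' _ h
        exact (Prod.ext_iff.mp h).2
      · rintro ⟨u, w⟩ hp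
        simp only [Finset.mem_filter, Finset.mem_product] at hp
        obtain ⟨⟨hu, hw⟩, _, rfl⟩ := hp
        exact ⟨w, by simp [hu, hw], by simp⟩
    have hcorr : ∑ p : F1 × F2, sgnf p.1 p.2 * sgnf (p + g).1 (p + g).2 = -1 := by
      rw [Fintype.sum_prod_type]
      apply sgnf_corr hF1 hF2 hc hm
      by_contra! h
      exact hg (Prod.ext h.1 h.2)
    have hsh : ∑ p : F1 × F2, sgnf (p + g).1 (p + g).2 = -1 := by
      rw [← hs]
      exact Equiv.sum_comp (Equiv.addRight g) (fun p : F1 × F2 => sgnf p.1 p.2)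
    have key : (4 * (Finset.univ.filter (fun p : F1 × F2 => p ∈ D ∧ p + g ∈ D)).card : ℤ)
        = q * (q + 2) - 3 := by
      have e : ((Finset.univ.filter (fun p : F1 × F2 => p ∈ D ∧ p + g ∈ D)).card : ℤ)
          = ∑ p : F1 × F2, (if p ∈ D then (1 : ℤ) else 0) * (if p + g ∈ D then (1 : ℤ) else 0) := by
        rw [Finset.card_filter]
        push_cast
        refine Finset.sum_congr rfl fun p _ => ?_
        by_cases hA : p ∈ D <;> by_cases hB : p + g ∈ D <;> simp [hA, hB]
      rw [e, Finset.mul_sum]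
      have : ∀ p : F1 × F2, 4 * ((if p ∈ D then (1 : ℤ) else 0) * (if p + g ∈ D then (1 : ℤ) else 0))
          = 1 + sgnf p.1 p.2 + sgnf (p + g).1 (p + g).2
            + sgnf p.1 p.2 * sgnf (p + g).1 (p + g).2 := by
        intro p
        linear_combination (2 * (if p + g ∈ D then (1 : ℤ) else 0)) * hmem p
          + (1 + sgnf p.1 p.2) * hmem (p + g)
      simp only [this, Finset.sum_add_distrib, hv, hs, hsh, hcorr]
      ring
    rw [hcard]
    have h3 : 4 * (Finset.univ.filter (fun p : F1 × F2 => p ∈ D ∧ p + g ∈ D)).card + 3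
        = q ^ 2 + 2 * q := by
      zify; linear_combination key
    omega
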